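/- Let α ∈ (0,1]. Let Ψ̃_1 and Ψ̃_2 be random sequences with values in [0,∞]^ℕ (with the product σ-algebra) that are almost surely nondecreasing, i.e. Ψ̃_j^{(i)} ≤ Ψ̃_j^{(i+1)} for all i ≥ 1 almost surely. For j = 1,2, d ≥ 1 and t_1, …, t_d ∈ [0,∞), set F̃_j^{[d]}(t_1,…,t_d) := ℙ(Ψ̃_j^{(1)} ≤ t_1, …, Ψ̃_j^{(d)} ≤ t_d), with the convention F̃_j^{[0]} := 1. Suppose there exists a family of functions F^{[d]} : [0,∞)^d → [0,1] such that for both j = 1 and j = 2, for every d ≥ 1 and all 0 ≤ t_1 ≤ ⋯ ≤ t_d, F^{[d]}(t_1,…,t_d) = α ∫_0^{t_1} ( F̃_j^{[d-1]}(t_2 − t_1 + x, …, t_d − t_1 + x) − F̃_j^{[d]}(x, t_2 − t_1 + x, …, t_d − t_1 + x) ) (t_1 − x)^{α-1} dx. Then Ψ̃_1 and Ψ̃_2 have the same law on [0,∞]^ℕ. -/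

import Mathlib

open MeasureTheory Set
open scoped ENNReal

/-- The distribution function of the first `d` coordinates of a `[0,∞]^ℕ`-valued random
sequence `Ψ` under `μ`, evaluated at the (real) thresholds `t 0, …, t (d-1)`.
For `d = 0` this is `μ` of the whole space, i.e. `1` for a probability measure. -/
noncomputable def jointCDF {Ω : Type*} [MeasurableSpace Ω] (μ : Measure Ω)
    (Ψ : Ω → ℕ → ℝ≥0∞) (d : ℕ) (t : ℕ → ℝ) : ℝ :=
  (μ {ω | ∀ i < d, Ψ ω i ≤ ENNReal.ofReal (t i)}).toReal


open Filter Topology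

noncomputable def powK (r : ℝ) : ℝ → ℝ≥0∞ :=
  (Ioi (0 : ℝ)).indicator (fun y => ENNReal.ofReal (y ^ r))

lemma measurable_powK (r : ℝ) : Measurable (powK r) := by
  unfold powK
  exact Measurable.indicator (by fun_prop) measurableSet_Ioi

noncomputable def posPart' (w : ℝ → ℝ) : ℝ → ℝ≥0∞ :=
  (Ioi (0 : ℝ)).indicator (fun y => ENNReal.ofReal (w y))

lemma measurable_posPart' {w : ℝ → ℝ} (hw : Measurable w) : Measurable (posPart' w) := by
  unfold posPart'
  exact Measurable.indicator (by fun_prop) measurableSet_Ioi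

lemma conv_powK {α : ℝ} (h0 : 0 < α) (h1 : α < 1) (x : ℝ) :
    lconvolution (powK (α - 1)) (powK (-α)) volume x
      = ENNReal.ofReal (ProbabilityTheory.beta α (1 - α)) * powK 0 x := by
  rw [lconvolution_def]
  by_cases hx : 0 < x
  · have hb := ProbabilityTheory.beta_pos h0 (sub_pos.2 h1)
    have hm : Measurable (fun y => powK (α - 1) y * powK (-α) (-y + x)) :=
      (measurable_powK _).mul ((measurable_powK _).comp (by fun_prop))
    have h2 : powK 0 x = 1 := by simp [powK, hx]
    rw [h2, mul_one]
    rw [← Real.smul_map_volume_mul_left hx.ne', lintegral_smul_measure,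
      lintegral_map hm (by fun_prop), smul_eq_mul, abs_of_pos hx]
    have key : ∀ z : ℝ, powK (α - 1) (x * z) * powK (-α) (-(x * z) + x)
        = ENNReal.ofReal (x⁻¹ * ProbabilityTheory.beta α (1 - α))
          * ProbabilityTheory.betaPDF α (1 - α) z := by
      intro z
      rw [ProbabilityTheory.betaPDF_eq]
      by_cases hz0 : 0 < z
      · by_cases hz1 : z < 1
        · have e : -(x * z) + x = x * (1 - z) := by ring
          have hz1' : 0 < 1 - z := by linarith
          have p1 : 0 < x * z := by positivity
          have p2 : 0 < x * (1 - z) := by positivity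
          rw [e, if_pos ⟨hz0, hz1⟩, powK, powK, indicator_of_mem (show x * z ∈ Ioi (0:ℝ) from p1),
            indicator_of_mem (show x * (1 - z) ∈ Ioi (0:ℝ) from p2),
            ← ENNReal.ofReal_mul (by positivity), ← ENNReal.ofReal_mul (by positivity)]
          congr 1
          rw [Real.mul_rpow hx.le hz0.le, Real.mul_rpow hx.le hz1'.le]
          have e2 : x ^ (α - 1) * x ^ (-α) = x⁻¹ := by
            rw [← Real.rpow_add hx, ← Real.rpow_neg_one]; congr 1; ring
          have e3 : (1 - α - 1) = -α := by ring
          rw [e3, ← e2]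
          field_simp
        · have : ¬ (0 < -(x * z) + x) := by nlinarith
          simp [powK, this, hz1]
      · have : ¬ (0 < x * z) := by
          have : z ≤ 0 := not_lt.1 hz0
          nlinarith
        simp only [powK]
        rw [indicator_of_notMem (by simpa using this)]
        simp [hz0]
    simp_rw [key]
    rw [lintegral_const_mul' _ _ ENNReal.ofReal_ne_top,
      ProbabilityTheory.lintegral_betaPDF_eq_one h0 (sub_pos.2 h1), mul_one,
      ← ENNReal.ofReal_mul hx.le]
    congr 1
    field_simp
  · have h2 : powK 0 x = 0 := by simp [powK, hx]
    rw [h2, mul_zero]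
    convert lintegral_zero with y
    by_cases hy : 0 < y
    · have : ¬ (0 < -y + x) := by linarith
      simp [powK, this]
    · simp [powK, hy]

lemma integrableOn_kernel {r : ℝ} (hr : -1 < r) (T : ℝ) :
    IntervalIntegrable (fun x : ℝ => (T - x) ^ r) volume 0 T := by
  have := (intervalIntegral.intervalIntegrable_rpow' (a := T) (b := 0) hr).comp_sub_left T
  simpa using this

lemma conv_eq {w : ℝ → ℝ} (hw : Measurable w) (h0 : ∀ x, 0 ≤ w x) (h1 : ∀ x, w x ≤ 1)
    {r : ℝ} (hr : -1 < r) {T : ℝ} (hT : 0 < T) :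
    lconvolution (posPart' w) (powK r) volume T
      = ENNReal.ofReal (∫ x in (0:ℝ)..T, w x * (T - x) ^ r) := by
  rw [intervalIntegral.integral_of_le hT.le, integral_Ioc_eq_integral_Ioo]
  have hk : IntegrableOn (fun x : ℝ => (T - x) ^ r) (Ioo 0 T) := by
    have := integrableOn_kernel hr T
    rw [intervalIntegrable_iff_integrableOn_Ioo_of_le hT.le] at this
    exact this
  rw [ofReal_integral_eq_lintegral_ofReal]
  · rw [lconvolution_def, ← lintegral_indicator measurableSet_Ioo]
    congr 1
    ext x
    by_cases hx0 : 0 < x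
    · by_cases hx1 : x < T
      · have p : 0 < -x + T := by linarith
        simp only [posPart', powK]
        rw [indicator_of_mem (show x ∈ Ioi (0:ℝ) from hx0),
          indicator_of_mem (show -x + T ∈ Ioi (0:ℝ) from p),
          indicator_of_mem (show x ∈ Ioo (0:ℝ) T from ⟨hx0, hx1⟩),
          ENNReal.ofReal_mul (h0 x)]
        congr 3; ring
      · have : -x + T ∉ Ioi (0:ℝ) := by simp; linarith
        have h' : x ∉ Ioo (0:ℝ) T := fun h => hx1 h.2
        simp only [powK]
        rw [indicator_of_notMem this, indicator_of_notMem h', mul_zero]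
    · have h' : x ∉ Ioo (0:ℝ) T := fun h => hx0 h.1
      simp only [posPart']
      rw [indicator_of_notMem (show x ∉ Ioi (0:ℝ) from hx0), indicator_of_notMem h', zero_mul]
  · refine Integrable.bdd_mul (c := 1) hk hw.aestronglyMeasurable ?_
    refine Eventually.of_forall fun x => ?_
    rw [Real.norm_eq_abs, abs_of_nonneg (h0 x)]; exact h1 x
  · refine ae_restrict_of_forall_mem measurableSet_Ioo fun x hx => ?_
    exact mul_nonneg (h0 x) (Real.rpow_nonneg (by linarith [hx.2]) _)

lemma conv_zero {w : ℝ → ℝ} {r : ℝ} {T : ℝ} (hT : T ≤ 0) :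
    lconvolution (posPart' w) (powK r) volume T = 0 := by
  rw [lconvolution_def]
  convert lintegral_zero with y
  by_cases hy : 0 < y
  · have : -y + T ∉ Ioi (0:ℝ) := by simp; linarith
    simp only [powK]
    rw [indicator_of_notMem this, mul_zero]
  · simp [posPart', hy]

lemma abel {α : ℝ} (hα : α ∈ Ioc (0:ℝ) 1) {w₁ w₂ : ℝ → ℝ} (hw₁ : Measurable w₁)
    (hw₂ : Measurable w₂) (h10 : ∀ x, 0 ≤ w₁ x) (h11 : ∀ x, w₁ x ≤ 1)
    (h20 : ∀ x, 0 ≤ w₂ x) (h21 : ∀ x, w₂ x ≤ 1)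
    (h : ∀ T, 0 ≤ T → ∫ x in (0:ℝ)..T, w₁ x * (T - x) ^ (α - 1)
      = ∫ x in (0:ℝ)..T, w₂ x * (T - x) ^ (α - 1)) {S : ℝ} (hS : 0 ≤ S) :
    ∫ x in (0:ℝ)..S, w₁ x = ∫ x in (0:ℝ)..S, w₂ x := by
  obtain ⟨ha0, ha1⟩ := hα
  rcases ha1.eq_or_lt with rfl | ha1
  · simpa using h S hS
  rcases hS.eq_or_lt with rfl | hS
  · simp
  have hc : lconvolution (posPart' w₁) (powK (α - 1)) volume
      = lconvolution (posPart' w₂) (powK (α - 1)) volume := by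
    ext T
    rcases le_or_gt T 0 with hT | hT
    · rw [conv_zero hT, conv_zero hT]
    · rw [conv_eq hw₁ h10 h11 (by linarith) hT, conv_eq hw₂ h20 h21 (by linarith) hT, h T hT.le]
  have hK : lconvolution (powK (α - 1)) (powK (-α)) volume
      = fun x => ENNReal.ofReal (ProbabilityTheory.beta α (1 - α)) * powK 0 x :=
    funext (conv_powK ha0 ha1)
  have main : ∀ w : ℝ → ℝ, Measurable w → (∀ x, 0 ≤ w x) → (∀ x, w x ≤ 1) →
      lconvolution (lconvolution (posPart' w) (powK (α - 1)) volume) (powK (-α)) volume S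
      = ENNReal.ofReal (ProbabilityTheory.beta α (1 - α))
        * ENNReal.ofReal (∫ x in (0:ℝ)..S, w x) := by
    intro w hw h0 h1
    have h3 := conv_eq hw h0 h1 (r := 0) (by norm_num) hS
    simp only [Real.rpow_zero, mul_one] at h3
    rw [← lconvolution_assoc (measurable_posPart' hw) (measurable_powK _) (measurable_powK _),
      hK, ← h3, lconvolution_def, lconvolution_def,
      ← lintegral_const_mul' _ _ ENNReal.ofReal_ne_top]
    congr 1; ext y; ring
  have e := (main w₁ hw₁ h10 h11).symm.trans ((congrArg (fun f =>
    lconvolution f (powK (-α)) volume S) hc).trans (main w₂ hw₂ h20 h21))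
  have hb := ProbabilityTheory.beta_pos ha0 (sub_pos.2 ha1)
  have e2 := (ENNReal.mul_right_inj (by simpa using hb) ENNReal.ofReal_ne_top).1 e
  exact (ENNReal.ofReal_eq_ofReal_iff
    (intervalIntegral.integral_nonneg hS.le fun x _ => h10 x)
    (intervalIntegral.integral_nonneg hS.le fun x _ => h20 x)).1 e2

lemma eq_zero_of_integral {u : ℝ → ℝ} (hu : Measurable u) (hb : ∀ x, |u x| ≤ 1)
    (hc : ∀ x, 0 ≤ x → ContinuousWithinAt u (Ioi x) x)
    (hi : ∀ S, 0 ≤ S → ∫ x in (0:ℝ)..S, u x = 0) {x : ℝ} (hx : 0 ≤ x) : u x = 0 := by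
  have hint : IntervalIntegrable u volume 0 x := by
    refine (intervalIntegrable_const (c := (1:ℝ))).mono_fun hu.aestronglyMeasurable ?_
    refine Eventually.of_forall fun y => ?_
    simpa using hb y
  have hd : HasDerivWithinAt (fun s => ∫ y in (0:ℝ)..s, u y) (u x) (Ici x) x :=
    intervalIntegral.integral_hasDerivWithinAt_right hint
      (hu.stronglyMeasurable.stronglyMeasurableAtFilter) (hc x hx)
  have hz : HasDerivWithinAt (fun s => ∫ y in (0:ℝ)..s, u y) 0 (Ici x) x :=
    (hasDerivWithinAt_const x (Ici x) (0:ℝ)).congr (fun s hs => hi s (hx.trans hs)) (hi x hx)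
  exact (uniqueDiffWithinAt_Ici x).eq_deriv _ hd hz

section CDF
variable {Ω : Type*} [MeasurableSpace Ω] (μ : Measure Ω) [IsProbabilityMeasure μ]
  {Ψ : Ω → ℕ → ℝ≥0∞}

lemma measurableSet_cdf (hΨ : Measurable Ψ) (d : ℕ) (c : ℕ → ℝ≥0∞) :
    MeasurableSet {ω | ∀ i < d, Ψ ω i ≤ c i} := by
  simp only [setOf_forall]
  refine MeasurableSet.iInter fun i => MeasurableSet.iInter fun _ => ?_
  exact measurableSet_le ((measurable_pi_apply i).comp hΨ) measurable_const

lemma cdf_nonneg (d : ℕ) (t : ℕ → ℝ) : 0 ≤ jointCDF μ Ψ d t := ENNReal.toReal_nonneg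

lemma cdf_le_one (d : ℕ) (t : ℕ → ℝ) : jointCDF μ Ψ d t ≤ 1 := by
  have : jointCDF μ Ψ d t = μ.real {ω | ∀ i < d, Ψ ω i ≤ ENNReal.ofReal (t i)} := rfl
  rw [this]; exact measureReal_le_one

lemma cdf_mono {d d' : ℕ} {t t' : ℕ → ℝ} (hd : d' ≤ d) (h : ∀ i < d', t i ≤ t' i) :
    jointCDF μ Ψ d t ≤ jointCDF μ Ψ d' t' := by
  unfold jointCDF
  refine ENNReal.toReal_mono (measure_ne_top _ _) (measure_mono ?_)
  intro ω hω i hi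
  exact (hω i (hi.trans_le hd)).trans (ENNReal.ofReal_le_ofReal (h i hi))

lemma cdf_measurable (d : ℕ) (s : ℕ → ℝ) :
    Measurable (fun x => jointCDF μ Ψ d (fun i => s i + x)) := by
  refine Monotone.measurable fun x y hxy => cdf_mono μ le_rfl fun i _ => ?_
  linarith

lemma cdf_rightCont (hΨ : Measurable Ψ) (d : ℕ) (s : ℕ → ℝ) (x : ℝ) :
    ContinuousWithinAt (fun x => jointCDF μ Ψ d (fun i => s i + x)) (Ioi x) x := by
  have h := tendsto_measure_biInter_gt (μ := μ) (a := x)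
    (s := fun y : ℝ => {ω | ∀ i < d, Ψ ω i ≤ ENNReal.ofReal (s i + y)})
    (fun r _ => (measurableSet_cdf hΨ d _).nullMeasurableSet)
    (fun a b _ hab ω hω i hi => (hω i hi).trans (ENNReal.ofReal_le_ofReal (by linarith)))
    ⟨x + 1, by simp, measure_ne_top _ _⟩
  have e : (⋂ r > x, {ω | ∀ i < d, Ψ ω i ≤ ENNReal.ofReal (s i + r)})
      = {ω | ∀ i < d, Ψ ω i ≤ ENNReal.ofReal (s i + x)} := by
    ext ω
    simp only [mem_iInter, mem_setOf_eq]
    constructor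
    · intro hω i hi
      have hc : Tendsto (fun r : ℝ => ENNReal.ofReal (s i + r)) (𝓝[>] x)
          (𝓝 (ENNReal.ofReal (s i + x))) := by
        have : Continuous (fun r : ℝ => ENNReal.ofReal (s i + r)) :=
          ENNReal.continuous_ofReal.comp (by fun_prop)
        exact this.continuousWithinAt
      refine ge_of_tendsto hc ?_
      filter_upwards [self_mem_nhdsWithin] with r hr
      exact hω r hr i hi
    · intro hω r hr i hi
      exact (hω i hi).trans (ENNReal.ofReal_le_ofReal (by linarith))
  rw [e] at h
  exact (ENNReal.tendsto_toReal (measure_ne_top _ _)).comp h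

end CDF

lemma cdf_eq {Ω₁ Ω₂ : Type*} [MeasurableSpace Ω₁] [MeasurableSpace Ω₂]
    (μ₁ : Measure Ω₁) (μ₂ : Measure Ω₂)
    [IsProbabilityMeasure μ₁] [IsProbabilityMeasure μ₂]
    (α : ℝ) (hα : α ∈ Ioc (0 : ℝ) 1)
    (Ψ₁ : Ω₁ → ℕ → ℝ≥0∞) (Ψ₂ : Ω₂ → ℕ → ℝ≥0∞)
    (hΨ₁ : Measurable Ψ₁) (hΨ₂ : Measurable Ψ₂)
    (F : ℕ → (ℕ → ℝ) → ℝ)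
    (hF₁ : ∀ d, 1 ≤ d → ∀ t : ℕ → ℝ, 0 ≤ t 0 → (∀ i, i + 1 < d → t i ≤ t (i + 1)) →
      F d t = α * ∫ x in (0 : ℝ)..(t 0),
        (jointCDF μ₁ Ψ₁ (d - 1) (fun i => t (i + 1) - t 0 + x)
          - jointCDF μ₁ Ψ₁ d (fun i => if i = 0 then x else t i - t 0 + x))
          * (t 0 - x) ^ (α - 1))
    (hF₂ : ∀ d, 1 ≤ d → ∀ t : ℕ → ℝ, 0 ≤ t 0 → (∀ i, i + 1 < d → t i ≤ t (i + 1)) →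
      F d t = α * ∫ x in (0 : ℝ)..(t 0),
        (jointCDF μ₂ Ψ₂ (d - 1) (fun i => t (i + 1) - t 0 + x)
          - jointCDF μ₂ Ψ₂ d (fun i => if i = 0 then x else t i - t 0 + x))
          * (t 0 - x) ^ (α - 1)) (d : ℕ) :
    ∀ t : ℕ → ℝ, (∀ i < d, 0 ≤ t i) → (∀ i, i + 1 < d → t i ≤ t (i + 1)) →
      jointCDF μ₁ Ψ₁ d t = jointCDF μ₂ Ψ₂ d t := by
  induction d with
  | zero => intro t _ _; simp [jointCDF]
  | succ d ih =>
    intro t ht0 htm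
    have hge : ∀ i < d + 1, t 0 ≤ t i := by
      intro i
      induction i with
      | zero => intro _; exact le_rfl
      | succ i ihi => intro hi; exact (ihi (by omega)).trans (htm i hi)
    set s : ℕ → ℝ := fun i => t i - t 0 with hs
    have hs0 : s 0 = 0 := by simp [hs]
    have hsm : ∀ i, i + 1 < d + 1 → s i ≤ s (i + 1) := fun i hi => by
      have := htm i hi; simp only [hs]; linarith
    have hif : ∀ T x : ℝ, (fun i => if i = 0 then x else (s i + T) - (s 0 + T) + x)
        = fun i => s i + x := by
      intro T x; ext i
      split_ifs with h
      · rw [h, hs0, zero_add]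
      · rw [hs0]; ring
    have hsh : ∀ T x : ℝ, (fun i => (s (i + 1) + T) - (s 0 + T) + x)
        = fun i => s (i + 1) + x := by
      intro T x; ext i; rw [hs0]; ring
    have hg : ∀ x, 0 ≤ x → jointCDF μ₁ Ψ₁ d (fun i => s (i + 1) + x)
        = jointCDF μ₂ Ψ₂ d (fun i => s (i + 1) + x) := by
      intro x hx
      refine ih _ (fun i hi => ?_) (fun i hi => ?_)
      · have := hge (i + 1) (by omega)
        simp only [hs]; linarith
      · have := hsm (i + 1) (by omega)
        linarith
    have key : ∀ S, 0 ≤ S →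
        ∫ x in (0:ℝ)..S, (jointCDF μ₁ Ψ₁ d (fun i => s (i + 1) + x)
          - jointCDF μ₁ Ψ₁ (d + 1) (fun i => s i + x))
        = ∫ x in (0:ℝ)..S, (jointCDF μ₂ Ψ₂ d (fun i => s (i + 1) + x)
          - jointCDF μ₂ Ψ₂ (d + 1) (fun i => s i + x)) := by
      intro S hS
      refine abel hα ((cdf_measurable μ₁ d (fun i => s (i + 1))).sub (cdf_measurable μ₁ (d + 1) s))
        ((cdf_measurable μ₂ d (fun i => s (i + 1))).sub (cdf_measurable μ₂ (d + 1) s))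
        (fun x => ?_) (fun x => ?_) (fun x => ?_) (fun x => ?_) ?_ hS
      · refine sub_nonneg.2 (cdf_mono μ₁ (by omega) fun i hi => ?_)
        have := hsm i (by omega)
        linarith
      · have h1 := cdf_le_one μ₁ (Ψ := Ψ₁) d (fun i => s (i + 1) + x)
        have h2 := cdf_nonneg μ₁ (Ψ := Ψ₁) (d + 1) (fun i => s i + x)
        exact (sub_le_self _ h2).trans h1
      · refine sub_nonneg.2 (cdf_mono μ₂ (by omega) fun i hi => ?_)
        have := hsm i (by omega)
        linarith
      · have h1 := cdf_le_one μ₂ (Ψ := Ψ₂) d (fun i => s (i + 1) + x)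
        have h2 := cdf_nonneg μ₂ (Ψ := Ψ₂) (d + 1) (fun i => s i + x)
        exact (sub_le_self _ h2).trans h1
      · intro T hT
        have a1 := hF₁ (d + 1) (by omega) (fun i => s i + T) (by simp [hs0, hT])
          (fun i hi => by have := hsm i hi; linarith)
        have a2 := hF₂ (d + 1) (by omega) (fun i => s i + T) (by simp [hs0, hT])
          (fun i hi => by have := hsm i hi; linarith)
        simp only [hif, hsh, Nat.add_sub_cancel] at a1 a2
        simp only [hs0, zero_add] at a1 a2
        exact mul_left_cancel₀ hα.1.ne' (a1.symm.trans a2)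
    have hint : ∀ {Ω : Type _} [MeasurableSpace Ω] (μ : Measure Ω) [IsProbabilityMeasure μ]
        (Ψ : Ω → ℕ → ℝ≥0∞) (n : ℕ) (r : ℕ → ℝ) (S : ℝ),
        IntervalIntegrable (fun x => jointCDF μ Ψ n (fun i => r i + x)) volume 0 S := by
      intro Ω _ μ _ Ψ n r S
      refine Monotone.intervalIntegrable fun x y hxy => cdf_mono μ le_rfl fun i _ => ?_
      linarith
    have hint' : ∀ (n : ℕ) (r : ℕ → ℝ) (S : ℝ),
        IntervalIntegrable (fun x => jointCDF μ₂ Ψ₂ n (fun i => r i + x)) volume 0 S := by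
      intro n r S
      refine Monotone.intervalIntegrable fun x y hxy => cdf_mono μ₂ le_rfl fun i _ => ?_
      linarith
    have fin := eq_zero_of_integral
      (u := fun x => jointCDF μ₁ Ψ₁ (d + 1) (fun i => s i + x)
        - jointCDF μ₂ Ψ₂ (d + 1) (fun i => s i + x))
      ((cdf_measurable μ₁ (d + 1) s).sub (cdf_measurable μ₂ (d + 1) s))
      (fun x => by
        rw [abs_le]
        have h1 := cdf_le_one μ₁ (Ψ := Ψ₁) (d + 1) (fun i => s i + x)
        have h2 := cdf_nonneg μ₁ (Ψ := Ψ₁) (d + 1) (fun i => s i + x)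
        have h3 := cdf_le_one μ₂ (Ψ := Ψ₂) (d + 1) (fun i => s i + x)
        have h4 := cdf_nonneg μ₂ (Ψ := Ψ₂) (d + 1) (fun i => s i + x)
        constructor <;> linarith)
      (fun x _ => (cdf_rightCont μ₁ hΨ₁ (d + 1) s x).sub (cdf_rightCont μ₂ hΨ₂ (d + 1) s x))
      (fun S hS => by
        have k := key S hS
        rw [intervalIntegral.integral_sub (hint μ₁ Ψ₁ d (fun i => s (i + 1)) S)
            (hint μ₁ Ψ₁ (d + 1) s S),
          intervalIntegral.integral_sub (hint' d (fun i => s (i + 1)) S) (hint' (d + 1) s S)] at k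
        have k2 : ∫ x in (0:ℝ)..S, jointCDF μ₁ Ψ₁ d (fun i => s (i + 1) + x)
            = ∫ x in (0:ℝ)..S, jointCDF μ₂ Ψ₂ d (fun i => s (i + 1) + x) := by
          refine intervalIntegral.integral_congr fun x hx => ?_
          rw [uIcc_of_le hS] at hx
          exact hg x hx.1
        rw [intervalIntegral.integral_sub (hint μ₁ Ψ₁ (d + 1) s S) (hint' (d + 1) s S)]
        linarith)
      (x := t 0) (ht0 0 (by omega))
    have e : (fun i => s i + t 0) = t := by ext i; simp [hs]
    simp only [e] at fin
    linarith

lemma isPi_C : IsPiSystem {A : Set (ℕ → ℝ≥0∞) | ∃ c : ℕ → ℝ≥0∞, ∃ d, (∀ i ≥ d, c i = ∞) ∧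
    A = Iic c} := by
  rintro _ ⟨c, d, hc, rfl⟩ _ ⟨c', d', hc', rfl⟩ _
  refine ⟨c ⊓ c', max d d', fun i hi => ?_, Iic_inter_Iic⟩
  simp [hc i (le_trans (le_max_left _ _) hi), hc' i (le_trans (le_max_right _ _) hi)]

lemma gen_C : (MeasurableSpace.pi : MeasurableSpace (ℕ → ℝ≥0∞)) =
    MeasurableSpace.generateFrom {A : Set (ℕ → ℝ≥0∞) | ∃ c : ℕ → ℝ≥0∞, ∃ d,
      (∀ i ≥ d, c i = ∞) ∧ A = Iic c} := by
  apply le_antisymm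
  · refine iSup_le fun i => ?_
    rw [← measurable_iff_comap_le]
    suffices key : ∀ a : ℝ≥0∞, @MeasurableSet (ℕ → ℝ≥0∞) (MeasurableSpace.generateFrom
        {A : Set (ℕ → ℝ≥0∞) | ∃ c : ℕ → ℝ≥0∞, ∃ d, (∀ i ≥ d, c i = ∞) ∧ A = Iic c})
        ((fun ψ : ℕ → ℝ≥0∞ => ψ i) ⁻¹' Iic a) from
      @measurable_of_Iic ℝ≥0∞ (ℕ → ℝ≥0∞) _ _ _
        (MeasurableSpace.generateFrom {A : Set (ℕ → ℝ≥0∞) | ∃ c : ℕ → ℝ≥0∞, ∃ d,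
        (∀ i ≥ d, c i = ∞) ∧ A = Iic c}) _ _ _ _ key
    intro a
    apply MeasurableSpace.measurableSet_generateFrom
    refine ⟨fun k => if k = i then a else ∞, i + 1, fun k hk => by simp; omega, ?_⟩
    ext ψ
    simp only [mem_preimage, mem_Iic, Pi.le_def]
    constructor
    · intro h k
      split_ifs with hk
      · rw [hk]; exact h
      · exact le_top
    · intro h; simpa using h i
  · refine MeasurableSpace.generateFrom_le ?_
    rintro _ ⟨c, d, hc, rfl⟩
    have : Iic c = ⋂ i, (fun ψ : ℕ → ℝ≥0∞ => ψ i) ⁻¹' Iic (c i) := by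
      ext ψ; simp [Pi.le_def]
    rw [this]
    exact MeasurableSet.iInter fun i => measurable_pi_apply i measurableSet_Iic

/-- For a.s. nondecreasing sequences, orthant probabilities are values of the joint CDF. -/
lemma orthant_reduce (c : ℕ → ℝ≥0∞) (d : ℕ) (hc : ∀ i ≥ d, c i = ∞) :
    ∃ (n : ℕ) (t : ℕ → ℝ), (∀ i < n, 0 ≤ t i) ∧ (∀ i, i + 1 < n → t i ≤ t (i + 1)) ∧
      ∀ ψ : ℕ → ℝ≥0∞, (∀ i, ψ i ≤ ψ (i + 1)) →
        (ψ ∈ Iic c ↔ ∀ i < n, ψ i ≤ ENNReal.ofReal (t i)) := by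
  classical
  set c' : ℕ → ℝ≥0∞ := fun i => ⨅ k, ⨅ (_ : i ≤ k), c k with hc'
  have hm : Monotone c' := fun i j hij =>
    le_iInf₂ fun k hk => iInf₂_le k (hij.trans hk)
  have htop : ∃ n, c' n = ∞ := ⟨d, by
    simp only [hc', iInf_eq_top]; exact fun k hk => hc k hk⟩
  have hlt : ∀ i < Nat.find htop, c' i ≠ ∞ := fun i hi => Nat.find_min htop hi
  refine ⟨Nat.find htop, fun i => (c' i).toReal, fun i _ => ENNReal.toReal_nonneg,
    fun i hi => ENNReal.toReal_mono (hlt _ hi) (hm (Nat.le_succ i)), fun ψ hψ => ?_⟩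
  have hψm : Monotone ψ := monotone_nat_of_le_succ hψ
  constructor
  · intro h i hi
    rw [ENNReal.ofReal_toReal (hlt i hi)]
    exact le_iInf₂ fun k hk => (hψm hk).trans (h k)
  · intro h i
    have h2 : c' i ≤ c i := iInf₂_le i le_rfl
    refine le_trans ?_ h2
    by_cases hi : i < Nat.find htop
    · have := h i hi
      rwa [ENNReal.ofReal_toReal (hlt i hi)] at this
    · have h3 := hm (not_lt.1 hi)
      rw [Nat.find_spec htop] at h3
      exact le_top.trans h3

theorem stmt1 {Ω₁ Ω₂ : Type*} [MeasurableSpace Ω₁] [MeasurableSpace Ω₂]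
    (μ₁ : Measure Ω₁) (μ₂ : Measure Ω₂)
    [IsProbabilityMeasure μ₁] [IsProbabilityMeasure μ₂]
    (α : ℝ) (hα : α ∈ Ioc (0 : ℝ) 1)
    (Ψ₁ : Ω₁ → ℕ → ℝ≥0∞) (Ψ₂ : Ω₂ → ℕ → ℝ≥0∞)
    (hΨ₁ : Measurable Ψ₁) (hΨ₂ : Measurable Ψ₂)
    (hmono₁ : ∀ᵐ ω ∂μ₁, ∀ i, Ψ₁ ω i ≤ Ψ₁ ω (i + 1))
    (hmono₂ : ∀ᵐ ω ∂μ₂, ∀ i, Ψ₂ ω i ≤ Ψ₂ ω (i + 1))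
    (F : ℕ → (ℕ → ℝ) → ℝ)
    (hF₁ : ∀ d, 1 ≤ d → ∀ t : ℕ → ℝ, 0 ≤ t 0 → (∀ i, i + 1 < d → t i ≤ t (i + 1)) →
      F d t = α * ∫ x in (0 : ℝ)..(t 0),
        (jointCDF μ₁ Ψ₁ (d - 1) (fun i => t (i + 1) - t 0 + x)
          - jointCDF μ₁ Ψ₁ d (fun i => if i = 0 then x else t i - t 0 + x))
          * (t 0 - x) ^ (α - 1))
    (hF₂ : ∀ d, 1 ≤ d → ∀ t : ℕ → ℝ, 0 ≤ t 0 → (∀ i, i + 1 < d → t i ≤ t (i + 1)) →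
      F d t = α * ∫ x in (0 : ℝ)..(t 0),
        (jointCDF μ₂ Ψ₂ (d - 1) (fun i => t (i + 1) - t 0 + x)
          - jointCDF μ₂ Ψ₂ d (fun i => if i = 0 then x else t i - t 0 + x))
          * (t 0 - x) ^ (α - 1)) :
    Measure.map Ψ₁ μ₁ = Measure.map Ψ₂ μ₂ := by
  haveI := Measure.isProbabilityMeasure_map (μ := μ₁) hΨ₁.aemeasurable
  haveI := Measure.isProbabilityMeasure_map (μ := μ₂) hΨ₂.aemeasurable
  refine ext_of_generate_finite _ gen_C isPi_C ?_ (by simp)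
  rintro _ ⟨c, d, hc, rfl⟩
  have hmeas : MeasurableSet (Iic c) := by
    rw [gen_C]
    exact MeasurableSpace.measurableSet_generateFrom ⟨c, d, hc, rfl⟩
  rw [Measure.map_apply hΨ₁ hmeas, Measure.map_apply hΨ₂ hmeas]
  obtain ⟨n, t, ht0, htm, hiff⟩ := orthant_reduce c d hc
  have e := cdf_eq μ₁ μ₂ α hα Ψ₁ Ψ₂ hΨ₁ hΨ₂ F hF₁ hF₂ n t ht0 htm
  have e1 : μ₁ (Ψ₁ ⁻¹' Iic c) = μ₁ {ω | ∀ i < n, Ψ₁ ω i ≤ ENNReal.ofReal (t i)} := by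
    refine measure_congr ?_
    filter_upwards [hmono₁] with ω hω
    exact propext (hiff (Ψ₁ ω) hω)
  have e2 : μ₂ (Ψ₂ ⁻¹' Iic c) = μ₂ {ω | ∀ i < n, Ψ₂ ω i ≤ ENNReal.ofReal (t i)} := by
    refine measure_congr ?_
    filter_upwards [hmono₂] with ω hω
    exact propext (hiff (Ψ₂ ω) hω)
  rw [e1, e2]
  exact (ENNReal.toReal_eq_toReal_iff' (measure_ne_top _ _) (measure_ne_top _ _)).1 e
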